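/- Let $k$ be an algebraically closed field of characteristic zero, $K$ a field extension of $k$, $n,p \geq 1$, and let $\{u, v_1,\dots,v_n, w_1,\dots,w_p\} \subseteq K$ be algebraically independent over $k$. Define $t_{j,k} := (u+v_j)/(v_j+w_k)$ for $1 \leq j \leq n$, $1 \leq k \leq p$. Then the intermediate field $k(t_{j,k} \mid 1 \leq j \leq n, 1 \leq k \leq p)$ has transcendence degree exactly $n+p-1$ over $k$. -/

import Mathlib

open IntermediateField in
/-- A field extension generated by the range of a family is algebraic over the subalgebra
generated by that family. -/
theorem isAlgebraic_algebraAdjoin_of_adjoin_eq_top {F E : Type*} [Field F] [Field E] [Algebra F E]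
    {s : Set E} (h : adjoin F s = ⊤) : Algebra.IsAlgebraic (Algebra.adjoin F s) E := by
  refine isAlgebraic_adjoin_iff_top.1 ⟨fun x => ?_⟩
  have hx : x ∈ adjoin F s := h ▸ mem_top
  exact isAlgebraic_algebraMap (⟨x, hx⟩ : adjoin F s)

open IntermediateField in
/-- A family of elements of an intermediate field `L` that generates `L` inside the ambient field
generates the whole of `L`. -/
theorem adjoin_range_eq_top_of_adjoin_range_coe {F E ι : Type*} [Field F] [Field E] [Algebra F E]
    {L : IntermediateField F E} (y : ι → L)
    (h : adjoin F (Set.range fun i => (y i : E)) = L) : adjoin F (Set.range y) = ⊤ := by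
  apply lift_injective L
  rw [lift_adjoin, lift_top, ← Set.range_comp]
  exact h

open IntermediateField in
/-- If a finite algebraically independent family `x` lies in the field generated by a family `y` of
the same cardinality, then `y` is algebraically independent. -/
theorem AlgebraicIndependent.of_mem_adjoin_range {F E ι κ : Type*} [Field F] [Field E] [Algebra F E]
    [Finite ι] {x : ι → E} (hx : AlgebraicIndependent F x) (e : κ ≃ ι) {y : κ → E}
    (h : ∀ i, x i ∈ adjoin F (Set.range y)) : AlgebraicIndependent F y := by
  have : Finite κ := .of_equiv ι e.symm
  let L := adjoin F (Set.range y)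
  let y' : κ → L := fun i => ⟨y i, subset_adjoin F _ ⟨i, rfl⟩⟩
  let x' : κ → L := fun i => ⟨x (e i), h (e i)⟩
  have hx' : AlgebraicIndependent F x' :=
    (AlgHom.algebraicIndependent_iff L.val L.val.injective).1 (hx.comp e e.injective)
  have := isAlgebraic_algebraAdjoin_of_adjoin_eq_top
    (adjoin_range_eq_top_of_adjoin_range_coe y' rfl)
  exact (Algebra.IsAlgebraic.isTranscendenceBasis_of_lift_le_trdeg_of_finite F y'
    hx'.lift_cardinalMk_le_trdeg).1.map' (f := L.val) L.val.injective

open IntermediateField in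
/-- An algebraically independent family `y` with `range y ⊆ s` whose field contains `s` is a
transcendence basis of the field generated by `s`. -/
theorem AlgebraicIndependent.isTranscendenceBasis_adjoin {F E ι : Type*} [Field F] [Field E]
    [Algebra F E] {y : ι → E} (hy : AlgebraicIndependent F y) {s : Set E} (hys : ∀ i, y i ∈ s)
    (hs : s ⊆ adjoin F (Set.range y)) :
    IsTranscendenceBasis F (fun i => ⟨y i, subset_adjoin F s (hys i)⟩ : ι → adjoin F s) := by
  have ind : AlgebraicIndependent F
      (fun i => ⟨y i, subset_adjoin F s (hys i)⟩ : ι → adjoin F s) :=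
    (AlgHom.algebraicIndependent_iff (adjoin F s).val (adjoin F s).val.injective).1 hy
  refine ind.isTranscendenceBasis_iff_isAlgebraic.2
    (isAlgebraic_algebraAdjoin_of_adjoin_eq_top (adjoin_range_eq_top_of_adjoin_range_coe _ ?_))
  exact le_antisymm (adjoin.mono F _ _ (Set.range_subset_iff.2 hys)) (adjoin_le_iff.2 hs)

/-- Two distinct members of an algebraically independent family do not sum to zero. -/
theorem AlgebraicIndependent.add_ne_zero {R A ι : Type*} [CommRing R] [Nontrivial R] [CommRing A]
    [Algebra R A] {x : ι → A} (hx : AlgebraicIndependent R x) {i j : ι} (hij : i ≠ j) :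
    x i + x j ≠ 0 := fun h =>
  one_ne_zero (((LinearIndepOn.pair_iff x hij).1
    (hx.linearIndependent.linearIndepOn (s := {i, j})) 1 1 (by simpa using h)).1)

/-- The relation satisfied by the array `(u + vⱼ) / (vⱼ + wₗ)`: the entry at `(v', w')` is
determined by the other three entries of a `2 × 2` block. -/
theorem twisted_entry_eq {K : Type*} [Field K] {u v w v' w' : K}
    (hu : u + v ≠ 0) (hu' : u + v' ≠ 0) (huw : w - u ≠ 0) :
    (u + v') / (v' + w') =
      (1 + (((u + v) / (v + w'))⁻¹ - 1) * (((u + v') / (v' + w))⁻¹ - 1) /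
        (((u + v) / (v + w))⁻¹ - 1))⁻¹ := by
  have e : ∀ a b : K, u + a ≠ 0 → ((u + a) / (a + b))⁻¹ - 1 = (b - u) / (u + a) := by
    intro a b ha
    rw [inv_div]
    field_simp
    ring
  rw [e _ _ hu, e _ _ hu', e _ _ hu]
  have : 1 + (w' - u) / (u + v) * ((w - u) / (u + v')) / ((w - u) / (u + v))
      = (v' + w') / (u + v') := by
    field_simp
    ring
  rw [this, inv_div]

/-- If `u, v₁,…,v_n, w₁,…,w_p ∈ K` (with `n,p ≥ 1`) are algebraically
independent over an algebraically closed field `k` of characteristic zero, then the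
intermediate field generated over `k` by the elements `t j l = (u+vⱼ)/(vⱼ+wₗ)` has
transcendence degree exactly `n+p-1` over `k`
(i.e. it admits a transcendence basis indexed by `Fin (n+p-1)`). -/
theorem twisted_slice_trdeg {k K : Type*} [Field k] [IsAlgClosed k] [CharZero k]
    [Field K] [Algebra k K] (n p : ℕ) (hn : 1 ≤ n) (hp : 1 ≤ p)
    (u : K) (v : Fin n → K) (w : Fin p → K)
    (hind : AlgebraicIndependent k (Sum.elim (fun _ : Fin 1 => u) (Sum.elim v w))) :
    ∃ b : Fin (n + p - 1) → (IntermediateField.adjoin k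
        {x : K | ∃ (j : Fin n) (l : Fin p),
          x = (u + v j) / (v j + w l)} : IntermediateField k K),
      IsTranscendenceBasis k b := by
  obtain ⟨n, rfl⟩ := Nat.exists_eq_add_of_le' hn
  obtain ⟨p, rfl⟩ := Nat.exists_eq_add_of_le' hp
  have huv : ∀ j, u + v j ≠ 0 := fun j =>
    hind.add_ne_zero (i := .inl 0) (j := .inr (.inl j)) Sum.inl_ne_inr
  have hvw : ∀ j l, v j + w l ≠ 0 := fun j l =>
    hind.add_ne_zero (i := .inr (.inl j)) (j := .inr (.inr l)) (by simp)
  have hwu : ∀ l, w l - u ≠ 0 := fun l h => by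
    exact Sum.inr_ne_inl (hind.injective (a₁ := .inr (.inr l)) (a₂ := .inl 0) (sub_eq_zero.1 h))
  let z : Fin (p + 1) ⊕ Fin n → K :=
    Sum.elim (fun l => (u + v 0) / (v 0 + w l)) (fun j => (u + v j.succ) / (v j.succ + w 0))
  let y : Fin 2 ⊕ (Fin (p + 1) ⊕ Fin n) → K := Sum.elim ![u, v 0] z
  have hy : AlgebraicIndependent k y := by
    refine hind.of_mem_adjoin_range (Fintype.equivOfCardEq (by simp; omega)) ?_
    set L := IntermediateField.adjoin k (Set.range y)
    have hyL : ∀ i, y i ∈ L := fun i => IntermediateField.subset_adjoin k _ ⟨i, rfl⟩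
    have hu : u ∈ L := hyL (.inl 0)
    have hv₀ : v 0 ∈ L := hyL (.inl 1)
    have hw : ∀ l, w l ∈ L := fun l => by
      have ht : (u + v 0) / (v 0 + w l) ∈ L := hyL (.inr (.inl l))
      have : w l = (u + v 0) / ((u + v 0) / (v 0 + w l)) - v 0 := by
        rw [div_div_cancel₀ (huv 0)]
        ring
      rw [this]
      exact sub_mem (div_mem (add_mem hu hv₀) ht) hv₀
    have hv : ∀ j, v j ∈ L := Fin.cases hv₀ fun j => by
      have ht : (u + v j.succ) / (v j.succ + w 0) ∈ L := hyL (.inr (.inr j))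
      have hne := hvw j.succ 0
      have : v j.succ = (w 0 * ((u + v j.succ) / (v j.succ + w 0)) - u) /
          (1 - (u + v j.succ) / (v j.succ + w 0)) := by
        have : 1 - (u + v j.succ) / (v j.succ + w 0) = (w 0 - u) / (v j.succ + w 0) := by
          field_simp
          ring
        have := hwu 0
        simp only [*]
        field_simp
        ring
      rw [this]
      exact div_mem (sub_mem (mul_mem (hw 0) ht) hu) (sub_mem (one_mem _) ht)
    rintro (i | j | l)
    exacts [hu, hv j, hw l]
  have hz : AlgebraicIndependent k z := hy.comp Sum.inr Sum.inr_injective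
  have hzs : ∀ i, z i ∈ {x : K | ∃ j l, x = (u + v j) / (v j + w l)} := by
    rintro (l | j)
    exacts [⟨0, l, rfl⟩, ⟨j.succ, 0, rfl⟩]
  refine ⟨_, (hz.isTranscendenceBasis_adjoin hzs ?_).comp_equiv
    (Fintype.equivOfCardEq (by simp; omega))⟩
  set L := IntermediateField.adjoin k (Set.range z)
  have hzL : ∀ i, z i ∈ L := fun i => IntermediateField.subset_adjoin k _ ⟨i, rfl⟩
  have h₀ : ∀ l, (u + v 0) / (v 0 + w l) ∈ L := fun l => hzL (.inl l)
  have h₁ : ∀ j, (u + v j) / (v j + w 0) ∈ L := Fin.cases (h₀ 0) fun j => hzL (.inr j)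
  rintro _ ⟨j, l, rfl⟩
  rw [twisted_entry_eq (w := w 0) (huv 0) (huv j) (hwu 0)]
  have hsub : ∀ {t : K}, t ∈ L → t⁻¹ - 1 ∈ L := fun ht => sub_mem (inv_mem ht) (one_mem _)
  exact inv_mem (add_mem (one_mem _)
    (div_mem (mul_mem (hsub (h₀ l)) (hsub (h₁ j))) (hsub (h₀ 0))))
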